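/- Let ℓ be an odd positive integer divisible by 3 and m = ℓ/3. If the {−1,+1}-sequences A = [a_1,…,a_ℓ] and B = [b_1,…,b_ℓ] form a Legendre pair of length ℓ, then A_1² + A_2² + A_3² + B_1² + B_2² + B_3² = 4m + 2, where A_k = Σ_{i=0}^{m−1} a_{3i+k} and B_k = Σ_{i=0}^{m−1} b_{3i+k} for k = 1,2,3. -/

import Mathlib

/-- The periodic autocorrelation function `PAF(A,s) = ∑_{i=1}^{ℓ} a_i a_{i+s}`,
indices mod `ℓ` (here indexed from 0). -/
def paf (ℓ : ℕ) (a : ℕ → ℤ) (s : ℕ) : ℤ :=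
  ∑ i ∈ Finset.range ℓ, a i * a ((i + s) % ℓ)

/-- Two `±1` sequences of length `ℓ` with entry sums equal to 1 form a Legendre pair if
`PAF(A,s) + PAF(B,s) = -2` for all `s = 1, …, (ℓ-1)/2`. -/
def IsLegendrePair (ℓ : ℕ) (a b : ℕ → ℤ) : Prop :=
  (∀ i < ℓ, a i = 1 ∨ a i = -1) ∧
  (∀ i < ℓ, b i = 1 ∨ b i = -1) ∧
  (∑ i ∈ Finset.range ℓ, a i = 1) ∧
  (∑ i ∈ Finset.range ℓ, b i = 1) ∧
  (∀ s : ℕ, 1 ≤ s → s ≤ (ℓ - 1) / 2 → paf ℓ a s + paf ℓ b s = -2)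

theorem sum_range_add_mod (n s : ℕ) (g : ℕ → ℤ) :
    ∑ i ∈ Finset.range n, g ((i + s) % n) = ∑ i ∈ Finset.range n, g i := by
  induction s with
  | zero =>
    refine Finset.sum_congr rfl fun i hi => ?_
    rw [Nat.add_zero, Nat.mod_eq_of_lt (Finset.mem_range.1 hi)]
  | succ s ih =>
    rw [← ih]
    have h₁ := Finset.sum_range_succ (fun i => g ((i + s) % n)) n
    have h₂ := Finset.sum_range_succ' (fun i => g ((i + s) % n)) n
    simp only [Nat.add_mod_left, zero_add] at h₁ h₂
    have h₃ : ∀ i, i + (s + 1) = i + 1 + s := fun i => by omega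
    simp only [h₃]
    linarith

theorem sum_mul_sum_range_add_mod (n : ℕ) (f : ℕ → ℤ) :
    ∑ t ∈ Finset.range n, ∑ j ∈ Finset.range n, f j * f ((j + t) % n)
      = (∑ j ∈ Finset.range n, f j) ^ 2 := by
  rw [Finset.sum_comm, sq, Finset.sum_mul]
  refine Finset.sum_congr rfl fun j _ => ?_
  rw [← Finset.mul_sum, ← sum_range_add_mod n j f]
  simp only [Nat.add_comm j]

theorem sum_range_three_mul (m : ℕ) (f : ℕ → ℤ) :
    ∑ i ∈ Finset.range (3 * m), f i = ∑ j ∈ Finset.range m, f (3 * j)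
      + ∑ j ∈ Finset.range m, f (3 * j + 1) + ∑ j ∈ Finset.range m, f (3 * j + 2) := by
  induction m with
  | zero => simp
  | succ m ih =>
    rw [Nat.mul_succ, Finset.sum_range_succ, Finset.sum_range_succ, Finset.sum_range_succ, ih]
    simp only [Finset.sum_range_succ]
    ring

theorem three_mul_add_mod (m k r : ℕ) (hr : r < 3) :
    (3 * k + r) % (3 * m) = 3 * (k % m) + r := by
  rw [Nat.mod_mul, Nat.mul_add_mod, Nat.mod_eq_of_lt hr, Nat.mul_add_div (by norm_num),
    Nat.div_eq_of_lt hr, Nat.add_zero, Nat.add_comm]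

theorem sum_paf_three_mul (m : ℕ) (a : ℕ → ℤ) :
    ∑ t ∈ Finset.range m, paf (3 * m) a (3 * t)
      = (∑ i ∈ Finset.range m, a (3 * i)) ^ 2
        + (∑ i ∈ Finset.range m, a (3 * i + 1)) ^ 2
        + (∑ i ∈ Finset.range m, a (3 * i + 2)) ^ 2 := by
  rw [← sum_mul_sum_range_add_mod m fun i => a (3 * i),
    ← sum_mul_sum_range_add_mod m fun i => a (3 * i + 1),
    ← sum_mul_sum_range_add_mod m fun i => a (3 * i + 2),
    ← Finset.sum_add_distrib, ← Finset.sum_add_distrib]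
  refine Finset.sum_congr rfl fun t _ => ?_
  rw [paf, sum_range_three_mul]
  have h₀ (j : ℕ) : (3 * j + 3 * t) % (3 * m) = 3 * ((j + t) % m) := by
    rw [← Nat.mul_add, Nat.mul_mod_mul_left]
  have h (j r : ℕ) (hr : r < 3) :
      (3 * j + r + 3 * t) % (3 * m) = 3 * ((j + t) % m) + r := by
    rw [← three_mul_add_mod m _ r hr]
    congr 1
    ring
  simp only [h₀, h _ 1 (by norm_num), h _ 2 (by norm_num)]

theorem paf_sub (ℓ : ℕ) (a : ℕ → ℤ) (s : ℕ) (hs : s ≤ ℓ) :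
    paf ℓ a (ℓ - s) = paf ℓ a s := by
  rw [paf, paf, ← sum_range_add_mod ℓ s]
  refine Finset.sum_congr rfl fun i hi => ?_
  rw [Nat.mod_add_mod, Nat.add_assoc, Nat.add_sub_cancel' hs, Nat.add_mod_right,
    Nat.mod_eq_of_lt (Finset.mem_range.1 hi), mul_comm]

theorem paf_zero (ℓ : ℕ) (a : ℕ → ℤ) (ha : ∀ i < ℓ, a i = 1 ∨ a i = -1) :
    paf ℓ a 0 = ℓ := by
  have h : ∀ i ∈ Finset.range ℓ, a i * a ((i + 0) % ℓ) = 1 := fun i hi => by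
    have hi := Finset.mem_range.1 hi
    rw [Nat.add_zero, Nat.mod_eq_of_lt hi]
    rcases ha i hi with h | h <;> simp [h]
  rw [paf, Finset.sum_congr rfl h]
  simp

theorem IsLegendrePair.paf_add_paf {ℓ : ℕ} {a b : ℕ → ℤ} (hab : IsLegendrePair ℓ a b)
    (hodd : Odd ℓ) {s : ℕ} (hs : 0 < s) (hsl : s < ℓ) :
    paf ℓ a s + paf ℓ b s = -2 := by
  obtain ⟨k, hk⟩ := hodd
  obtain ⟨-, -, -, -, h⟩ := hab
  by_cases hsk : s ≤ (ℓ - 1) / 2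
  · exact h s hs hsk
  · rw [← paf_sub ℓ a s hsl.le, ← paf_sub ℓ b s hsl.le]
    exact h (ℓ - s) (by omega) (by omega)

/-- If `(A,B)` is a Legendre pair of odd length `ℓ = 3m`, then
`A₁² + A₂² + A₃² + B₁² + B₂² + B₃² = 4m + 2`, where `Aₖ, Bₖ` are the partial sums of
`A, B` over the three residue classes of positions mod 3. -/
theorem six_squares_of_legendre_pair (ℓ m : ℕ) (hpos : 0 < ℓ) (hodd : Odd ℓ)
    (hm : ℓ = 3 * m) (a b : ℕ → ℤ) (hab : IsLegendrePair ℓ a b) :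
    (∑ i ∈ Finset.range m, a (3 * i)) ^ 2
      + (∑ i ∈ Finset.range m, a (3 * i + 1)) ^ 2
      + (∑ i ∈ Finset.range m, a (3 * i + 2)) ^ 2
      + (∑ i ∈ Finset.range m, b (3 * i)) ^ 2
      + (∑ i ∈ Finset.range m, b (3 * i + 1)) ^ 2
      + (∑ i ∈ Finset.range m, b (3 * i + 2)) ^ 2 = 4 * (m : ℤ) + 2 := by
  subst hm
  have hA := sum_paf_three_mul m a
  have hB := sum_paf_three_mul m b
  obtain ⟨n, rfl⟩ : ∃ n, m = n + 1 := ⟨m - 1, by omega⟩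
  have hsum : ∑ t ∈ Finset.range n,
      (paf (3 * (n + 1)) a (3 * (t + 1)) + paf (3 * (n + 1)) b (3 * (t + 1)))
        = ∑ _t ∈ Finset.range n, (-2 : ℤ) :=
    Finset.sum_congr rfl fun t ht => hab.paf_add_paf hodd (by omega) (by
      have := Finset.mem_range.1 ht
      omega)
  rw [Finset.sum_add_distrib, Finset.sum_const, Finset.card_range, nsmul_eq_mul] at hsum
  rw [Finset.sum_range_succ', Nat.mul_zero, paf_zero _ _ hab.1] at hA
  rw [Finset.sum_range_succ', Nat.mul_zero, paf_zero _ _ hab.2.1] at hB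
  push_cast at hA hB ⊢
  linarith
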